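/- arXiv:0908.2442 — 3 statements merged into one kernel-verified Lean document; each statement's English description precedes it below -/
import Mathlib

section
/- Let k ≥ 3 be an integer, c ∈ ℂ, z ∈ ℂ with z ≠ 0, and let V = { c + z·exp(2πi·j/k) : j = 0, 1, …, k−1 } be the vertex set of a regular k-gon. Then the number of ordered triples (p, q, r) ∈ V³ with p ≠ q, q ≠ r, and |p − q| = |p − r| equals exactly 2·k·⌊(k−1)/2⌋. -/
open Polynomial in
/-- There are `2·⌊(k-1)/2⌋` complex `k`-th roots of unity other than `±1`. -/
theorem card_nthRootsFinset_filter_sq_ne_one {k : ℕ} (hk : 0 < k) :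
    ((nthRootsFinset k (1 : ℂ)).filter (fun t => t ^ 2 ≠ 1)).card = 2 * ((k - 1) / 2) := by
  have hcard : (nthRootsFinset k (1 : ℂ)).card = k :=
    (Complex.isPrimitiveRoot_exp k hk.ne').card_nthRootsFinset
  have hsplit : ((nthRootsFinset k (1 : ℂ)).filter (fun t => t ^ 2 = 1)).card +
      ((nthRootsFinset k (1 : ℂ)).filter (fun t => t ^ 2 ≠ 1)).card = k :=
    (Finset.card_filter_add_card_filter_not _).trans hcard
  rcases Nat.even_or_odd' k with ⟨m, rfl | rfl⟩
  · have h : (nthRootsFinset (2 * m) (1 : ℂ)).filter (fun t => t ^ 2 = 1) = {1, -1} := by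
      ext t
      simp only [Finset.mem_filter, mem_nthRootsFinset hk, Finset.mem_insert,
        Finset.mem_singleton, ← sq_eq_one_iff]
      exact ⟨fun h => h.2, fun h => ⟨by rw [pow_mul, h, one_pow], h⟩⟩
    rw [h, Finset.card_pair (by norm_num)] at hsplit
    omega
  · have h : (nthRootsFinset (2 * m + 1) (1 : ℂ)).filter (fun t => t ^ 2 = 1) = {1} := by
      ext t
      simp only [Finset.mem_filter, mem_nthRootsFinset hk, Finset.mem_singleton]
      constructor
      · rintro ⟨h1, h2⟩
        simpa [pow_succ, pow_mul, h2] using h1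
      · rintro rfl
        simp
    rw [h, Finset.card_singleton] at hsplit
    omega

/-- Two points of the unit circle equidistant from a third one `u` are equal or mirror images
in the diameter through `u`. -/
theorem eq_or_mul_eq_sq_of_norm_sub_eq {u v w : ℂ} (hu : ‖u‖ = 1) (hv : ‖v‖ = 1) (hw : ‖w‖ = 1)
    (h : ‖u - v‖ = ‖u - w‖) : v = w ∨ v * w = u ^ 2 := by
  have hu0 : u ≠ 0 := norm_ne_zero_iff.1 (by simp [hu])
  have hv0 : v ≠ 0 := norm_ne_zero_iff.1 (by simp [hv])
  have hw0 : w ≠ 0 := norm_ne_zero_iff.1 (by simp [hw])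
  have h2 : (u - v) * (u⁻¹ - v⁻¹) = (u - w) * (u⁻¹ - w⁻¹) := by
    rw [Complex.inv_eq_conj hu, Complex.inv_eq_conj hv, Complex.inv_eq_conj hw,
      ← map_sub, ← map_sub, Complex.mul_conj', Complex.mul_conj', h]
  field_simp at h2
  have h3 : (v - w) * (v * w - u ^ 2) = 0 := by linear_combination -h2
  rcases mul_eq_zero.1 h3 with h | h
  · exact .inl (sub_eq_zero.1 h)
  · exact .inr (sub_eq_zero.1 h)

/-- The rotations of a point `u` by a unit complex number `t` and by its inverse are equidistant
from `u`. -/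
theorem norm_sub_mul_eq_norm_sub_mul_inv {t : ℂ} (ht : ‖t‖ = 1) (u : ℂ) :
    ‖u - u * t‖ = ‖u - u * t⁻¹‖ := by
  have ht0 : t ≠ 0 := norm_ne_zero_iff.1 (by simp [ht])
  have h : u - u * t = -t * (u - u * t⁻¹) := by field_simp; ring
  rw [h, norm_mul, norm_neg, ht, one_mul]

open Polynomial in
/-- The points `exp (2πi·j/k)`, `0 ≤ j < k`, are the complex `k`-th roots of unity. -/
theorem image_exp_range_eq_nthRootsFinset {k : ℕ} (hk : 0 < k) :
    (Finset.range k).image (fun j : ℕ => Complex.exp (2 * Real.pi * Complex.I * j / k)) =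
      nthRootsFinset k (1 : ℂ) := by
  have hζ := Complex.isPrimitiveRoot_exp k hk.ne'
  have : NeZero k := ⟨hk.ne'⟩
  have hpow (j : ℕ) : Complex.exp (2 * Real.pi * Complex.I * j / k) =
      Complex.exp (2 * Real.pi * Complex.I / k) ^ j := by
    rw [← Complex.exp_nat_mul]
    ring_nf
  ext t
  simp only [Finset.mem_image, Finset.mem_range, mem_nthRootsFinset hk, hpow]
  constructor
  · rintro ⟨j, -, rfl⟩
    rw [pow_right_comm, hζ.pow_eq_one, one_pow]
  · exact hζ.eq_pow_of_pow_eq_one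

open scoped Classical in
/-- The vertex set `V` of a regular `k`-gon (`k ≥ 3`) has exactly
`2·k·⌊(k-1)/2⌋` ordered isosceles triples `(p,q,r) ∈ V³` with `p ≠ q`, `q ≠ r`
and `|p - q| = |p - r|`. -/
theorem stmt_4 (k : ℕ) (hk : 3 ≤ k) (c z : ℂ) (hz : z ≠ 0) (V : Finset ℂ)
    (hV : V = (Finset.range k).image
        (fun j : ℕ => c + z * Complex.exp (2 * Real.pi * Complex.I * j / k))) :
    ((V ×ˢ V ×ˢ V).filter (fun pqr : ℂ × ℂ × ℂ =>
        pqr.1 ≠ pqr.2.1 ∧ pqr.2.1 ≠ pqr.2.2 ∧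
          ‖pqr.1 - pqr.2.1‖ = ‖pqr.1 - pqr.2.2‖)).card
      = 2 * k * ((k - 1) / 2) := by
  have hk0 : 0 < k := by omega
  set R := Polynomial.nthRootsFinset k (1 : ℂ) with hR
  have hcard : R.card = k := (Complex.isPrimitiveRoot_exp k hk0.ne').card_nthRootsFinset
  have memR {t : ℂ} : t ∈ R ↔ t ^ k = 1 := Polynomial.mem_nthRootsFinset hk0 1
  have normR {t : ℂ} (ht : t ∈ R) : ‖t‖ = 1 :=
    Complex.norm_eq_one_of_pow_eq_one (memR.1 ht) hk0.ne'
  have neR {t : ℂ} (ht : t ∈ R) : t ≠ 0 := norm_ne_zero_iff.1 (by simp [normR ht])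
  have hVR : V = R.image (fun u => c + z * u) := by
    rw [hV, hR, ← image_exp_range_eq_nthRootsFinset hk0, Finset.image_image]
    rfl
  have memV {u : ℂ} (hu : u ^ k = 1) : c + z * u ∈ V :=
    hVR ▸ Finset.mem_image_of_mem _ (memR.2 hu)
  have hsub (u v : ℂ) : ‖(c + z * u) - (c + z * v)‖ = ‖z‖ * ‖u - v‖ := by
    rw [← norm_mul]
    ring_nf
  trans (R ×ˢ R.filter (fun t => t ^ 2 ≠ 1)).card
  · symm
    refine Finset.card_bij
      (fun ut _ => (c + z * ut.1, c + z * (ut.1 * ut.2), c + z * (ut.1 * ut.2⁻¹))) ?_ ?_ ?_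
    · rintro ⟨u, t⟩ h
      simp only [Finset.mem_product, Finset.mem_filter] at h
      obtain ⟨hu, ht, ht2⟩ := h
      have hu0 := neR hu
      have ht0 := neR ht
      simp only [Finset.mem_product, Finset.mem_filter]
      refine ⟨⟨memV (memR.1 hu), memV ?_, memV ?_⟩, ?_, ?_, ?_⟩
      · rw [mul_pow, memR.1 hu, memR.1 ht, one_mul]
      · rw [mul_pow, inv_pow, memR.1 hu, memR.1 ht, inv_one, one_mul]
      · intro h
        have h1 : t = 1 := by simpa [hz, hu0] using h
        exact ht2 (by simp [h1])
      · intro h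
        have h1 : t = t⁻¹ := by simpa [hz, hu0] using h
        exact ht2 (by rw [sq]; nth_rw 2 [h1]; exact mul_inv_cancel₀ ht0)
      · rw [hsub, hsub, norm_sub_mul_eq_norm_sub_mul_inv (normR ht)]
    · rintro ⟨u, t⟩ h ⟨u', t'⟩ - heq
      have hu0 : u ≠ 0 := neR (Finset.mem_product.1 h).1
      simp only [Prod.mk.injEq, add_right_inj, mul_right_inj' hz] at heq
      obtain ⟨rfl, h2, -⟩ := heq
      rw [mul_right_inj' hu0] at h2
      rw [h2]
    · rintro ⟨p, q, r⟩ h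
      simp only [Finset.mem_product, Finset.mem_filter, hVR, Finset.mem_image] at h
      obtain ⟨⟨⟨u, hu, rfl⟩, ⟨v, hv, rfl⟩, ⟨w, hw, rfl⟩⟩, -, hvw, hd⟩ := h
      have hu0 := neR hu
      have hv0 := neR hv
      have hne : v ≠ w := fun h => hvw (by rw [h])
      rw [hsub, hsub, mul_right_inj' (norm_ne_zero_iff.2 hz)] at hd
      have hvwu := (eq_or_mul_eq_sq_of_norm_sub_eq (normR hu) (normR hv) (normR hw) hd).resolve_left
        hne
      refine ⟨(u, v / u), ?_, ?_⟩
      · simp only [Finset.mem_product, Finset.mem_filter]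
        refine ⟨hu, memR.2 ?_, fun h => hne ?_⟩
        · rw [div_pow, memR.1 hu, memR.1 hv, div_one]
        · field_simp at h
          exact mul_left_cancel₀ hv0 (by rw [hvwu, ← h, sq])
      · have hw' : u * (v / u)⁻¹ = w := by
          field_simp
          exact hvwu.symm
        simp only [hw', mul_div_cancel₀ _ hu0]
  · rw [Finset.card_product, hcard, hR, card_nthRootsFinset_filter_sq_ne_one hk0]
    ring
end

section
/- Let S ⊆ ℂ be a finite set of n points with n ≥ 3. Then the total number of regular polygons with vertices in S, i.e., the sum over all integers k with 3 ≤ k ≤ n of the number of subsets V ⊆ S that are vertex sets of regular k-gons, is at most n²·log n (natural logarithm); more precisely it is at most n(n−1)·Σ_{k=3}^{n} 1/k. -/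
/-- `V` is the vertex set of a regular `k`-gon: there are `c z : ℂ` with `z ≠ 0`
such that `V = { c + z·exp(2πi·j/k) : j = 0, 1, …, k-1 }`. -/
def IsRegularGonVertexSet (k : ℕ) (V : Finset ℂ) : Prop :=
  ∃ c z : ℂ, z ≠ 0 ∧
    (V : Set ℂ) = {x : ℂ | ∃ j : ℕ, j < k ∧
      x = c + z * Complex.exp (2 * Real.pi * Complex.I * j / k)}

/-- A regular `k`-gon with centre `c` and a vertex `c + z` is the solution set of
`(x - c) ^ k = z ^ k`. -/
lemma IsRegularGonVertexSet.exists_mem_iff {k : ℕ} (hk : k ≠ 0) {V : Finset ℂ}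
    (h : IsRegularGonVertexSet k V) :
    ∃ c z : ℂ, z ≠ 0 ∧ ∀ x, x ∈ V ↔ (x - c) ^ k = z ^ k := by
  obtain ⟨c, z, hz, hV⟩ := h
  have hω := Complex.isPrimitiveRoot_exp k hk
  have hpow (j : ℕ) : Complex.exp (2 * Real.pi * Complex.I * j / k) =
      Complex.exp (2 * Real.pi * Complex.I / k) ^ j := by
    rw [← Complex.exp_nat_mul]
    congr 1
    ring
  refine ⟨c, z, hz, fun x => ?_⟩
  rw [← Finset.mem_coe, hV]
  simp only [Set.mem_ofPred_eq, hpow]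
  constructor
  · rintro ⟨j, -, rfl⟩
    rw [add_sub_cancel_left, mul_pow, ← pow_mul, mul_comm j, pow_mul, hω.pow_eq_one, one_pow,
      mul_one]
  · intro hx
    have : NeZero k := ⟨hk⟩
    obtain ⟨j, hj, hjx⟩ := hω.eq_pow_of_pow_eq_one (ξ := (x - c) / z) (by
      rw [div_pow, hx, div_self (pow_ne_zero k hz)])
    refine ⟨j, hj, ?_⟩
    rw [hjx]
    field_simp
    ring

open scoped Classical in
/-- An ordered pair of points is a counterclockwise edge of at most one regular `k`-gon. -/
lemma mul_card_regularGon_le (S : Finset ℂ) {k : ℕ} (hk : 2 ≤ k) :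
    k * (S.powerset.filter (fun V => IsRegularGonVertexSet k V)).card ≤ S.offDiag.card := by
  have hk0 : k ≠ 0 := by omega
  obtain ⟨ω, hω⟩ : ∃ ω : ℂ, IsPrimitiveRoot ω k := ⟨_, Complex.isPrimitiveRoot_exp k hk0⟩
  have hω1 : ω - 1 ≠ 0 := sub_ne_zero.2 (hω.ne_one (by omega))
  have hω0 : ω ≠ 0 := hω.ne_zero hk0
  have hex (V : Finset ℂ) : ∃ c z : ℂ, IsRegularGonVertexSet k V →
      z ≠ 0 ∧ ∀ x, x ∈ V ↔ (x - c) ^ k = z ^ k := by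
    by_cases h : IsRegularGonVertexSet k V
    · obtain ⟨c, z, hcz⟩ := h.exists_mem_iff hk0
      exact ⟨c, z, fun _ => hcz⟩
    · exact ⟨0, 0, fun h' => absurd h' h⟩
  choose c z hcz using hex
  have hroot (V : Finset ℂ) (j : ℕ) : (z V * ω ^ j) ^ k = z V ^ k := by
    rw [mul_pow, ← pow_mul, mul_comm j, pow_mul, hω.pow_eq_one, one_pow, mul_one]
  rw [← Finset.card_range k, ← Finset.card_product, Finset.card_range]
  refine Finset.card_le_card_of_injOn
    (fun p => (c p.2 + z p.2 * ω ^ p.1, c p.2 + z p.2 * ω ^ (p.1 + 1))) ?_ ?_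
  · rintro ⟨j, V⟩ hp
    simp only [Finset.coe_product, Set.mem_prod, Finset.mem_coe, Finset.mem_filter,
      Finset.mem_powerset] at hp
    obtain ⟨-, hVS, hV⟩ := hp
    obtain ⟨hz, hmem⟩ := hcz V hV
    have hin (i : ℕ) : c V + z V * ω ^ i ∈ S :=
      hVS ((hmem _).2 (by rw [add_sub_cancel_left, hroot]))
    simp only [Finset.mem_coe, Finset.mem_offDiag]
    refine ⟨hin _, hin _, fun h => ?_⟩
    have h0 : z V * ω ^ j * (ω - 1) = 0 := by
      rw [pow_succ] at h
      linear_combination -h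
    exact mul_ne_zero (mul_ne_zero hz (pow_ne_zero j hω0)) hω1 h0
  · rintro ⟨i, V⟩ hp ⟨j, W⟩ hq h
    simp only [Finset.coe_product, Set.mem_prod, Finset.mem_coe, Finset.mem_filter,
      Finset.mem_range] at hp hq
    obtain ⟨hi, -, hV⟩ := hp
    obtain ⟨hj, -, hW⟩ := hq
    obtain ⟨hz, hmemV⟩ := hcz V hV
    obtain ⟨-, hmemW⟩ := hcz W hW
    simp only [Prod.mk.injEq, pow_succ] at h
    obtain ⟨h1, h2⟩ := h
    have hzz : z V * ω ^ i = z W * ω ^ j :=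
      mul_right_cancel₀ hω1 (by linear_combination h2 - h1)
    have hcc : c V = c W := by linear_combination h1 - hzz
    have hVW : V = W := by
      ext x
      rw [hmemV, hmemW, hcc, ← hroot V i, hzz, hroot]
    subst hVW
    rw [hω.pow_inj hi hj (mul_left_cancel₀ hz hzz)]

lemma sum_Icc_three_one_div_le_log {n : ℕ} (hn : 3 ≤ n) :
    ∑ k ∈ Finset.Icc 3 n, (1 : ℝ) / k ≤ Real.log n := by
  have h := harmonic_le_one_add_log n
  rw [harmonic_eq_sum_Icc, ← Finset.add_sum_Ioc_eq_sum_Icc (by omega : 1 ≤ n)] at h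
  push_cast at h
  have hsub : ∑ k ∈ Finset.Icc 3 n, (1 : ℝ) / k ≤ ∑ k ∈ Finset.Ioc 1 n, (k : ℝ)⁻¹ := by
    simp only [one_div]
    refine Finset.sum_le_sum_of_subset_of_nonneg (fun k hk => ?_) fun _ _ _ => by positivity
    simp only [Finset.mem_Icc, Finset.mem_Ioc] at hk ⊢
    omega
  linarith [inv_one (G := ℝ)]

open scoped Classical in
/-- For a set `S` of `n ≥ 3` points, the total number of regular polygons with
vertices in `S` is at most `n(n-1)·Σ_{k=3}^{n} 1/k`, and hence at most `n²·log n`. -/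
theorem stmt_8 (S : Finset ℂ) (hn : 3 ≤ S.card) :
    ((∑ k ∈ Finset.Icc 3 S.card,
        (S.powerset.filter (fun V => IsRegularGonVertexSet k V)).card : ℕ) : ℝ)
        ≤ (S.card : ℝ) * ((S.card : ℝ) - 1) * ∑ k ∈ Finset.Icc 3 S.card, (1 : ℝ) / k
      ∧
    ((∑ k ∈ Finset.Icc 3 S.card,
        (S.powerset.filter (fun V => IsRegularGonVertexSet k V)).card : ℕ) : ℝ)
        ≤ (S.card : ℝ) ^ 2 * Real.log (S.card : ℝ) := by
  have hmain : ((∑ k ∈ Finset.Icc 3 S.card,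
      (S.powerset.filter (fun V => IsRegularGonVertexSet k V)).card : ℕ) : ℝ)
      ≤ (S.card : ℝ) * ((S.card : ℝ) - 1) * ∑ k ∈ Finset.Icc 3 S.card, (1 : ℝ) / k := by
    push_cast
    rw [Finset.mul_sum]
    refine Finset.sum_le_sum fun k hk => ?_
    have hk3 : 3 ≤ k := (Finset.mem_Icc.1 hk).1
    have hk0 : (0 : ℝ) < k := by exact_mod_cast (by omega : 0 < k)
    have h := mul_card_regularGon_le S (k := k) (by omega)
    rw [Finset.offDiag_card] at h
    have h' := (Nat.cast_le (α := ℝ)).2 h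
    rw [Nat.cast_sub (Nat.le_mul_self _)] at h'
    push_cast at h'
    rw [mul_one_div, le_div_iff₀ hk0]
    linarith
  refine ⟨hmain, hmain.trans ?_⟩
  have hn0 : (3 : ℝ) ≤ S.card := by exact_mod_cast hn
  exact mul_le_mul (by nlinarith) (sum_Icc_three_one_div_le_log hn)
    (Finset.sum_nonneg fun _ _ => by positivity) (by positivity)
end

section
/- Let S ⊆ ℂ be a finite set of n ≥ 1 points, let α > 0 be a real number, and suppose the number of ordered isosceles triples of S is at most n^{2+2α}. If V ⊆ S is the vertex set of a regular k-gon with k ≥ n^α (and k ≥ 3), then the number of ordered isosceles triples of S all three of whose points lie in V satisfies: 3n² times this number is at least the total number of ordered isosceles triples of S. In other words, at least a 1/(3n²) fraction of the ordered isosceles triples of S is contained in V. -/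
open scoped Classical in
/-- The ordered isosceles triples of a finite set `S ⊆ ℂ`: the triples
`(p, q, r) ∈ S³` with `p ≠ q`, `q ≠ r` and `|p - q| = |p - r|`. -/
noncomputable def isoTriples (S : Finset ℂ) : Finset (ℂ × ℂ × ℂ) :=
  (S ×ˢ S ×ˢ S).filter (fun t => t.1 ≠ t.2.1 ∧ t.2.1 ≠ t.2.2 ∧
    ‖t.1 - t.2.1‖ = ‖t.1 - t.2.2‖)

/-- A regular `k`-gon contains every point `c + z ζ ^ m`, where `ζ` is a primitive `k`-th root
of unity. -/
lemma IsRegularGonVertexSet.exists_primitiveRoot {k : ℕ} {V : Finset ℂ} (hk : k ≠ 0)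
    (h : IsRegularGonVertexSet k V) :
    ∃ c z ζ : ℂ, z ≠ 0 ∧ IsPrimitiveRoot ζ k ∧ ∀ m : ℕ, c + z * ζ ^ m ∈ V := by
  obtain ⟨c, z, hz, hV⟩ := h
  have hζ := Complex.isPrimitiveRoot_exp k hk
  refine ⟨c, z, _, hz, hζ, fun m => ?_⟩
  rw [← Finset.mem_coe, hV]
  refine ⟨m % k, Nat.mod_lt _ (Nat.pos_of_ne_zero hk), ?_⟩
  rw [← pow_mod_orderOf, ← hζ.eq_orderOf, ← Complex.exp_nat_mul]
  congr 3
  ring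

/-- A regular `k`-gon contains at least `k (k - 2)` ordered isosceles triples. -/
lemma IsRegularGonVertexSet.mul_sub_two_le_card_isoTriples {k : ℕ} {V : Finset ℂ} (hk : k ≠ 0)
    (h : IsRegularGonVertexSet k V) : k * (k - 2) ≤ (isoTriples V).card := by
  obtain ⟨c, z, ζ, hz, hζ, hmem⟩ := h.exists_primitiveRoot hk
  have hζ0 : ζ ≠ 0 := hζ.ne_zero hk
  have hnorm : ‖ζ‖ = 1 := hζ.norm'_eq_one hk
  have hcard : k * (k - 2) ≤
      (Finset.range k ×ˢ (Finset.Ico 1 k).erase (k / 2)).card := by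
    rw [Finset.card_product, Finset.card_range]
    have := Finset.pred_card_le_card_erase (s := Finset.Ico 1 k) (a := k / 2)
    rw [Nat.card_Ico] at this
    exact Nat.mul_le_mul_left k (by omega)
  refine hcard.trans (Finset.card_le_card_of_injOn
    (fun t => (c + z * ζ ^ t.1, c + z * ζ ^ (t.1 + t.2), c + z * ζ ^ (t.1 + (k - t.2)))) ?_ ?_)
  · rintro ⟨a, d⟩ had
    simp only [Finset.mem_coe, Finset.mem_product, Finset.mem_range, Finset.mem_erase,
      Finset.mem_Ico] at had
    obtain ⟨ha, hd2, hd1, hdk⟩ := had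
    simp only [isoTriples, Finset.mem_coe, Finset.mem_filter, Finset.mem_product, hmem, true_and,
      ne_eq]
    simp only [add_right_inj, mul_right_inj' hz, pow_add, mul_right_inj' (pow_ne_zero a hζ0)]
    refine ⟨fun h => ?_, fun h => ?_, ?_⟩
    · exact hζ.pow_ne_one_of_pos_of_lt (by omega) hdk
        (mul_left_cancel₀ (pow_ne_zero a hζ0) (by rw [mul_one]; exact h.symm))
    · have := hζ.pow_inj hdk (by omega) h
      omega
    · have hinv : ζ ^ (k - d) * ζ ^ d = 1 := by
        rw [← pow_add, Nat.sub_add_cancel hdk.le, hζ.pow_eq_one]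
      have hreflect : c + z * ζ ^ a - (c + z * (ζ ^ a * ζ ^ (k - d))) =
          -(ζ ^ (k - d) * (c + z * ζ ^ a - (c + z * (ζ ^ a * ζ ^ d)))) := by
        linear_combination (-z * ζ ^ a) * hinv
      rw [hreflect, norm_neg, norm_mul, norm_pow, hnorm, one_pow, one_mul]
  · rintro ⟨a, d⟩ had ⟨b, e⟩ hbe h
    simp only [Finset.mem_coe, Finset.mem_product, Finset.mem_range, Finset.mem_erase,
      Finset.mem_Ico] at had hbe
    simp only [Prod.mk.injEq, add_right_inj, mul_right_inj' hz] at h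
    obtain rfl := hζ.pow_inj had.1 hbe.1 h.1
    have hde := h.2.1
    rw [pow_add, pow_add, mul_right_inj' (pow_ne_zero a hζ0)] at hde
    rw [hζ.pow_inj had.2.2.2 hbe.2.2.2 hde]

/-- If a set `S` of `n ≥ 1` points has at most `n^(2+2α)` ordered isosceles
triples, then for any vertex set `V ⊆ S` of a regular `k`-gon with `k ≥ n^α`
(and `k ≥ 3`), at least a `1/(3n²)` fraction of the ordered isosceles triples of
`S` lies entirely in `V`. -/
theorem stmt_9 (S : Finset ℂ) (hn : 1 ≤ S.card) (α : ℝ) (hα : 0 < α)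
    (htotal : ((isoTriples S).card : ℝ) ≤ (S.card : ℝ) ^ (2 + 2 * α))
    (V : Finset ℂ) (hVS : V ⊆ S) (k : ℕ) (hk3 : 3 ≤ k)
    (hkα : (S.card : ℝ) ^ α ≤ (k : ℝ)) (hreg : IsRegularGonVertexSet k V) :
    ((isoTriples S).card : ℝ) ≤ 3 * (S.card : ℝ) ^ 2 * ((isoTriples V).card : ℝ) := by
  have hn0 : (0 : ℝ) < S.card := by exact_mod_cast hn
  have hk3' : (3 : ℝ) ≤ k := by exact_mod_cast hk3
  have hV : (k : ℝ) * (k - 2) ≤ (isoTriples V).card := by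
    have := hreg.mul_sub_two_le_card_isoTriples (by omega)
    rw [← Nat.cast_two, ← Nat.cast_sub (by omega)]
    exact_mod_cast this
  calc ((isoTriples S).card : ℝ) ≤ (S.card : ℝ) ^ (2 + 2 * α) := htotal
    _ = (S.card : ℝ) ^ 2 * ((S.card : ℝ) ^ α) ^ 2 := by
      rw [Real.rpow_add hn0, mul_comm 2 α, Real.rpow_mul hn0.le]
      norm_cast
    _ ≤ (S.card : ℝ) ^ 2 * (k : ℝ) ^ 2 := by gcongr
    _ ≤ (S.card : ℝ) ^ 2 * (3 * (isoTriples V).card) := by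
      gcongr
      nlinarith
    _ = 3 * (S.card : ℝ) ^ 2 * (isoTriples V).card := by ring
end
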